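/- arXiv:1310.4559 — 4 statements merged into one kernel-verified Lean document; each statement's English description precedes it below -/
import Mathlib

section
/- On SU(2), the 3-form C_{1,3} = (1/(2πi))² · (−1/6) · tr((h⁻¹dh)³) is closed, and on SU(2) × SU(2) the Polyakov–Wiegmann type identity ε₀*C_{1,3} − ε₁*C_{1,3} + ε₂*C_{1,3} + d C_{2,2} = 0 holds, where C_{2,2} = (1/(2πi))² · (1/2) · tr(h₂⁻¹ h₁⁻¹ dh₁ dh₂); that is, C_{1,3} + C_{2,2} satisfies the first two cocycle conditions in the total complex of the simplicial de Rham double complex of N SU(2) (whose total 4-cocycle represents the second Chern class). -/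
/-! The second-Chern-class cocycle `C_{1,3} + C_{2,2}` on the simplicial manifold
`N SU(2)`.  Since `SU(2)` is an embedded submanifold of the vector space
`M₂(ℂ)` of 2×2 complex matrices, a differential form on `SU(2)` given by a global
matrix formula is formalized as the pointwise formula evaluated at points
`h ∈ SU(2)` on tangent vectors `v` with `h⁻¹v ∈ 𝔰𝔲(2)`; the exterior derivative of
such a form is the (ambient) exterior derivative of the formula, which pulls back
to the exterior derivative on the submanifold. -/

attribute [local instance]
  Matrix.linftyOpNormedAddCommGroup Matrix.linftyOpNormedSpace

noncomputable section

abbrev M2 := Matrix (Fin 2) (Fin 2) ℂ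

/-- `v` is tangent to `SU(2)` at `h`: `h⁻¹v` is anti-Hermitian and traceless. -/
def suTangent (h v : M2) : Prop :=
  star (h⁻¹ * v) = -(h⁻¹ * v) ∧ (h⁻¹ * v).trace = 0

/-- The 3-form `C_{1,3} = (1/(2πi))² ⬝ (−1/6) ⬝ tr((h⁻¹dh)³)`, evaluated at `h` on
tangent vectors `v 0, v 1, v 2`. -/
def C13 (h : M2) (v : Fin 3 → M2) : ℂ :=
  (1 / (2 * Real.pi * Complex.I)) ^ 2 * (-1 / 6) *
    ∑ σ : Equiv.Perm (Fin 3), ((Equiv.Perm.sign σ : ℤ) : ℂ) *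
      (h⁻¹ * v (σ 0) * (h⁻¹ * v (σ 1)) * (h⁻¹ * v (σ 2))).trace

/-- The 2-form `C_{2,2} = (1/(2πi))² ⬝ (1/2) ⬝ tr(h₂⁻¹h₁⁻¹ dh₁ dh₂)` on
`SU(2) × SU(2)`, evaluated at `(h₁, h₂)` on tangent vectors `v, w`. -/
def C22 (h : M2 × M2) (v w : M2 × M2) : ℂ :=
  (1 / (2 * Real.pi * Complex.I)) ^ 2 * (1 / 2) *
    ((h.2⁻¹ * h.1⁻¹ * v.1 * w.2).trace - (h.2⁻¹ * h.1⁻¹ * w.1 * v.2).trace)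

/-- The exterior derivative of a 3-form on (an open set of) the vector space `M₂(ℂ)`:
`(dω)_h(v₀,…,v₃) = ∑ᵢ (−1)ⁱ ∂_{vᵢ} (x ↦ ω_x(v₀,…,v̂ᵢ,…,v₃)) (h)`. -/
def extDeriv3 (ω : M2 → (Fin 3 → M2) → ℂ) (h : M2) (v : Fin 4 → M2) : ℂ :=
  ∑ i : Fin 4, (-1 : ℂ) ^ (i : ℕ) *
    fderiv ℝ (fun x => ω x (fun j => v (i.succAbove j))) h (v i)

/-- The exterior derivative of a 2-form on (an open set of) `M₂(ℂ) × M₂(ℂ)`. -/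
def extDeriv2 (ω : M2 × M2 → M2 × M2 → M2 × M2 → ℂ) (p : M2 × M2) (v : Fin 3 → M2 × M2) : ℂ :=
  ∑ i : Fin 3, (-1 : ℂ) ^ (i : ℕ) *
    fderiv ℝ (fun x => ω x (v (i.succAbove 0)) (v (i.succAbove 1))) p (v i)

section Derivatives

attribute [local instance] Matrix.linftyOpNormedRing Matrix.linftyOpNormedAlgebra

/-- The derivative of matrix inversion at an invertible matrix. -/
theorem hasFDerivAt_matrix_inv {h : M2} (hh : IsUnit h) :
    ∃ f' : M2 →L[ℝ] M2, HasFDerivAt (fun x : M2 => x⁻¹) f' h ∧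
      ∀ w, f' w = -(h⁻¹ * w * h⁻¹) := by
  obtain ⟨u, rfl⟩ := hh
  have key := hasFDerivAt_ringInverse (𝕜 := ℝ) u
  have hinv : (fun x : M2 => x⁻¹) = Ring.inverse :=
    funext Matrix.nonsing_inv_eq_ringInverse
  rw [hinv]
  refine ⟨_, key, fun w => ?_⟩
  rw [← Matrix.coe_units_inv]
  rfl

theorem HasFDerivAt.matrix_trace {E : Type*} [NormedAddCommGroup E] [NormedSpace ℝ E]
    {f : E → M2} {f' : E →L[ℝ] M2} {x : E} (hf : HasFDerivAt f f' x) :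
    HasFDerivAt (fun y => (f y).trace)
      ((LinearMap.toContinuousLinearMap (Matrix.traceLinearMap (Fin 2) ℝ ℂ)).comp f') x :=
  (LinearMap.toContinuousLinearMap
    (Matrix.traceLinearMap (Fin 2) ℝ ℂ)).hasFDerivAt.comp x hf

/-- The derivative of `x ↦ tr (x⁻¹a x⁻¹b x⁻¹c)`. -/
theorem hasFDerivAt_trace_cubic {h : M2} (hh : IsUnit h) (a b c : M2) :
    ∃ f' : M2 →L[ℝ] ℂ,
      HasFDerivAt (fun x : M2 => (x⁻¹ * a * (x⁻¹ * b) * (x⁻¹ * c)).trace) f' h ∧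
      ∀ w, f' w = -((h⁻¹ * w * (h⁻¹ * a) * (h⁻¹ * b) * (h⁻¹ * c)).trace
        + (h⁻¹ * a * (h⁻¹ * w) * (h⁻¹ * b) * (h⁻¹ * c)).trace
        + (h⁻¹ * a * (h⁻¹ * b) * (h⁻¹ * w) * (h⁻¹ * c)).trace) := by
  obtain ⟨g, hg, hgw⟩ := hasFDerivAt_matrix_inv hh
  refine ⟨_, (((hg.mul_const' a).mul' (hg.mul_const' b)).mul'
    (hg.mul_const' c)).matrix_trace, fun w => ?_⟩
  change (h⁻¹ * a * (h⁻¹ * b) * (g w * c)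
    + (h⁻¹ * a * (g w * b) + g w * a * (h⁻¹ * b)) * (h⁻¹ * c)).trace = _
  simp only [hgw, mul_assoc, add_mul, neg_mul, mul_neg, Matrix.trace_add, Matrix.trace_neg]
  ring

/-- The derivative of `x ↦ tr (x₂⁻¹ x₁⁻¹ a b)`. -/
theorem hasFDerivAt_trace_inv_mul_inv {h₁ h₂ : M2} (hh₁ : IsUnit h₁) (hh₂ : IsUnit h₂)
    (a b : M2) :
    ∃ f' : M2 × M2 →L[ℝ] ℂ,
      HasFDerivAt (fun x : M2 × M2 => (x.2⁻¹ * x.1⁻¹ * a * b).trace) f' (h₁, h₂) ∧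
      ∀ w, f' w = -((h₂⁻¹ * w.2 * h₂⁻¹ * h₁⁻¹ * a * b).trace
        + (h₂⁻¹ * h₁⁻¹ * w.1 * h₁⁻¹ * a * b).trace) := by
  obtain ⟨g₁, hg₁, hgw₁⟩ := hasFDerivAt_matrix_inv hh₁
  obtain ⟨g₂, hg₂, hgw₂⟩ := hasFDerivAt_matrix_inv hh₂
  have d₁ : HasFDerivAt (fun x : M2 × M2 => x.1⁻¹) _ (h₁, h₂) :=
    HasFDerivAt.comp (h₁, h₂) (g := fun x : M2 => x⁻¹) hg₁ hasFDerivAt_fst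
  have d₂ : HasFDerivAt (fun x : M2 × M2 => x.2⁻¹) _ (h₁, h₂) :=
    HasFDerivAt.comp (h₁, h₂) (g := fun x : M2 => x⁻¹) hg₂ hasFDerivAt_snd
  refine ⟨_, (((d₂.mul' d₁).mul_const' a).mul_const' b).matrix_trace, fun w => ?_⟩
  change ((h₂⁻¹ * g₁ w.1 + g₂ w.2 * h₁⁻¹) * a * b).trace = _
  simp only [hgw₁, hgw₂, mul_assoc, add_mul, neg_mul, mul_neg, Matrix.trace_add,
    Matrix.trace_neg]
  ring

end Derivatives

/-- The alternating sum over `S₃`, written out. -/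
theorem sum_perm_fin_three_sign (f : Fin 3 → Fin 3 → Fin 3 → ℂ) :
    ∑ σ : Equiv.Perm (Fin 3), ((Equiv.Perm.sign σ : ℤ) : ℂ) * f (σ 0) (σ 1) (σ 2) =
      f 0 1 2 - f 0 2 1 - f 1 0 2 + f 1 2 0 + f 2 0 1 - f 2 1 0 := by
  have huniv : (Finset.univ : Finset (Equiv.Perm (Fin 3))) =
      {1, Equiv.swap 1 2, Equiv.swap 0 1, Equiv.swap 0 1 * Equiv.swap 1 2,
        Equiv.swap 1 2 * Equiv.swap 0 1, Equiv.swap 0 2} := by decide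
  have e₁₂ : ∀ i, Equiv.swap (1 : Fin 3) 2 i = ![0, 2, 1] i := by decide
  have e₀₁ : ∀ i, Equiv.swap (0 : Fin 3) 1 i = ![1, 0, 2] i := by decide
  have e₀₂ : ∀ i, Equiv.swap (0 : Fin 3) 2 i = ![2, 1, 0] i := by decide
  rw [huniv, Finset.sum_insert (by decide), Finset.sum_insert (by decide),
    Finset.sum_insert (by decide), Finset.sum_insert (by decide),
    Finset.sum_insert (by decide), Finset.sum_singleton]
  simp [e₁₂, e₀₁, e₀₂, Equiv.Perm.sign_swap']
  ring

theorem fderiv_C13 {h : M2} (hh : IsUnit h) (v : Fin 3 → M2) (w : M2) :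
    fderiv ℝ (fun x => C13 x v) h w =
      (1 / (2 * Real.pi * Complex.I)) ^ 2 * (1 / 6) *
        ∑ σ : Equiv.Perm (Fin 3), ((Equiv.Perm.sign σ : ℤ) : ℂ) *
          ((h⁻¹ * w * (h⁻¹ * v (σ 0)) * (h⁻¹ * v (σ 1)) * (h⁻¹ * v (σ 2))).trace
          + (h⁻¹ * v (σ 0) * (h⁻¹ * w) * (h⁻¹ * v (σ 1)) * (h⁻¹ * v (σ 2))).trace
          + (h⁻¹ * v (σ 0) * (h⁻¹ * v (σ 1)) * (h⁻¹ * w) * (h⁻¹ * v (σ 2))).trace) := by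
  choose f' hf' hfw using fun σ : Equiv.Perm (Fin 3) =>
    hasFDerivAt_trace_cubic hh (v (σ 0)) (v (σ 1)) (v (σ 2))
  have H := (HasFDerivAt.fun_sum (u := Finset.univ) fun σ _ =>
    (hf' σ).const_mul ((Equiv.Perm.sign σ : ℤ) : ℂ)).const_mul
      ((1 / (2 * Real.pi * Complex.I)) ^ 2 * (-1 / 6) : ℂ)
  have H' := congrArg (fun L => L w) H.fderiv
  refine H'.trans ?_
  refine (congrArg (fun z : ℂ => _ * z) (sum_apply Finset.univ
    (fun σ => ((Equiv.Perm.sign σ : ℤ) : ℂ) • f' σ) w)).trans ?_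
  have hterm : ∀ σ, (((Equiv.Perm.sign σ : ℤ) : ℂ) • f' σ) w =
      ((Equiv.Perm.sign σ : ℤ) : ℂ) * f' σ w := fun _ => rfl
  simp only [hterm, hfw, mul_neg, Finset.sum_neg_distrib]
  ring

theorem fderiv_C22 {h₁ h₂ : M2} (hh₁ : IsUnit h₁) (hh₂ : IsUnit h₂) (v w u : M2 × M2) :
    fderiv ℝ (fun x => C22 x v w) (h₁, h₂) u =
      (1 / (2 * Real.pi * Complex.I)) ^ 2 * (1 / 2) *
        ((h₂⁻¹ * u.2 * h₂⁻¹ * h₁⁻¹ * w.1 * v.2).trace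
          + (h₂⁻¹ * h₁⁻¹ * u.1 * h₁⁻¹ * w.1 * v.2).trace
          - (h₂⁻¹ * u.2 * h₂⁻¹ * h₁⁻¹ * v.1 * w.2).trace
          - (h₂⁻¹ * h₁⁻¹ * u.1 * h₁⁻¹ * v.1 * w.2).trace) := by
  obtain ⟨f, hf, hfw⟩ := hasFDerivAt_trace_inv_mul_inv hh₁ hh₂ v.1 w.2
  obtain ⟨g, hg, hgw⟩ := hasFDerivAt_trace_inv_mul_inv hh₁ hh₂ w.1 v.2
  have H := (hf.sub hg).const_mul ((1 / (2 * Real.pi * Complex.I)) ^ 2 * (1 / 2) : ℂ)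
  have H' := congrArg (fun L => L u) H.fderiv
  refine H'.trans ?_
  change _ * (f u - g u) = _
  rw [hfw, hgw]
  ring

theorem trace_rotate (a b c d : M2) :
    (a * b * c * d).trace = (d * a * b * c).trace := by
  rw [Matrix.trace_mul_comm]; simp only [mul_assoc]

/-- `C13` is closed on all of `GL₂(ℂ)`. -/
theorem extDeriv3_C13 {h : M2} (hh : IsUnit h) (v : Fin 4 → M2) : extDeriv3 C13 h v = 0 := by
  have s00 : (0 : Fin 4).succAbove 0 = 1 := rfl
  have s01 : (0 : Fin 4).succAbove 1 = 2 := rfl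
  have s02 : (0 : Fin 4).succAbove 2 = 3 := rfl
  have s10 : (1 : Fin 4).succAbove 0 = 0 := rfl
  have s11 : (1 : Fin 4).succAbove 1 = 2 := rfl
  have s12 : (1 : Fin 4).succAbove 2 = 3 := rfl
  have s20 : (2 : Fin 4).succAbove 0 = 0 := rfl
  have s21 : (2 : Fin 4).succAbove 1 = 1 := rfl
  have s22 : (2 : Fin 4).succAbove 2 = 3 := rfl
  have s30 : (3 : Fin 4).succAbove 0 = 0 := rfl
  have s31 : (3 : Fin 4).succAbove 1 = 1 := rfl
  have s32 : (3 : Fin 4).succAbove 2 = 2 := rfl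
  unfold extDeriv3
  simp only [fderiv_C13 hh]
  have key := fun (i : Fin 4) => sum_perm_fin_three_sign (fun p q r =>
    (h⁻¹ * v i * (h⁻¹ * v (i.succAbove p)) * (h⁻¹ * v (i.succAbove q)) *
        (h⁻¹ * v (i.succAbove r))).trace
      + (h⁻¹ * v (i.succAbove p) * (h⁻¹ * v i) * (h⁻¹ * v (i.succAbove q)) *
        (h⁻¹ * v (i.succAbove r))).trace
      + (h⁻¹ * v (i.succAbove p) * (h⁻¹ * v (i.succAbove q)) * (h⁻¹ * v i) *
        (h⁻¹ * v (i.succAbove r))).trace)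
  simp only [key, Fin.sum_univ_four, s00, s01, s02, s10, s11, s12, s20, s21, s22, s30, s31, s32]
  generalize h⁻¹ * v 0 = a
  generalize h⁻¹ * v 1 = b
  generalize h⁻¹ * v 2 = c
  generalize h⁻¹ * v 3 = d
  have r1 : ∀ x y z : M2, (x * a * y * z).trace = (a * y * z * x).trace :=
    fun x y z => (trace_rotate a y z x).symm
  have r2 : ∀ x y z : M2, (x * y * a * z).trace = (a * z * x * y).trace :=
    fun x y z => by rw [trace_rotate, trace_rotate]
  have r3 : ∀ x y z : M2, (x * y * z * a).trace = (a * x * y * z).trace :=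
    fun x y z => trace_rotate x y z a
  simp only [r1, r2, r3]
  norm_num
  ring

/-- `C13` depends only on the conjugacy class of the triple `h⁻¹v`. -/
theorem C13_of_conj {h g : M2} (hg : IsUnit g) {v X : Fin 3 → M2}
    (hv : ∀ i, h⁻¹ * v i = g⁻¹ * X i * g) :
    C13 h v = (1 / (2 * Real.pi * Complex.I)) ^ 2 * (-1 / 6) *
      ((X 0 * X 1 * X 2).trace - (X 0 * X 2 * X 1).trace - (X 1 * X 0 * X 2).trace
        + (X 1 * X 2 * X 0).trace + (X 2 * X 0 * X 1).trace - (X 2 * X 1 * X 0).trace) := by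
  have hdet := (Matrix.isUnit_iff_isUnit_det g).1 hg
  have hconj : ∀ a b c : M2,
      (g⁻¹ * a * g * (g⁻¹ * b * g) * (g⁻¹ * c * g)).trace = (a * b * c).trace := by
    intro a b c
    rw [Matrix.trace_mul_comm]
    simp only [mul_assoc, Matrix.mul_nonsing_inv_cancel_left _ _ hdet]
    rw [Matrix.trace_mul_comm]
    simp only [mul_assoc, Matrix.mul_nonsing_inv _ hdet, mul_one]
    rw [Matrix.trace_mul_comm]
    simp only [mul_assoc]
  simp only [C13, hv, hconj]
  rw [sum_perm_fin_three_sign fun p q r => (X p * X q * X r).trace]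

/-- The Polyakov–Wiegmann identity on all of `GL₂(ℂ) × GL₂(ℂ)`. -/
theorem polyakovWiegmann {h₁ h₂ : M2} (hh₁ : IsUnit h₁) (hh₂ : IsUnit h₂)
    (v : Fin 3 → M2 × M2) :
    C13 h₂ (fun i => (v i).2)
      - C13 (h₁ * h₂) (fun i => (v i).1 * h₂ + h₁ * (v i).2)
      + C13 h₁ (fun i => (v i).1)
      + extDeriv2 C22 (h₁, h₂) v = 0 := by
  have hd₁ := (Matrix.isUnit_iff_isUnit_det h₁).1 hh₁
  have hd₂ := (Matrix.isUnit_iff_isUnit_det h₂).1 hh₂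
  have c₁ : C13 h₁ (fun i => (v i).1) = _ :=
    C13_of_conj (g := 1) (X := fun i => h₁⁻¹ * (v i).1) isUnit_one (by simp)
  have c₂ : C13 h₂ (fun i => (v i).2) = _ :=
    C13_of_conj (X := fun i => (v i).2 * h₂⁻¹) hh₂
      (by simp [mul_assoc, Matrix.nonsing_inv_mul _ hd₂])
  have c₁₂ : C13 (h₁ * h₂) (fun i => (v i).1 * h₂ + h₁ * (v i).2) = _ :=
    C13_of_conj (X := fun i => h₁⁻¹ * (v i).1 + (v i).2 * h₂⁻¹) hh₂
      (by simp [mul_assoc, mul_add, add_mul, Matrix.mul_inv_rev, Matrix.nonsing_inv_mul _ hd₂,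
        Matrix.nonsing_inv_mul_cancel_left _ _ hd₁])
  have w₁ : ∀ a b c : M2, (h₂⁻¹ * a * h₂⁻¹ * h₁⁻¹ * b * c).trace =
      (a * h₂⁻¹ * (h₁⁻¹ * b) * (c * h₂⁻¹)).trace := fun a b c => by
    simp only [mul_assoc]; rw [Matrix.trace_mul_comm]; simp only [mul_assoc]
  have w₂ : ∀ a b c : M2, (h₂⁻¹ * h₁⁻¹ * a * h₁⁻¹ * b * c).trace =
      (h₁⁻¹ * a * (h₁⁻¹ * b) * (c * h₂⁻¹)).trace := fun a b c => by
    simp only [mul_assoc]; rw [Matrix.trace_mul_comm]; simp only [mul_assoc]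
  have s00 : (0 : Fin 3).succAbove 0 = 1 := rfl
  have s01 : (0 : Fin 3).succAbove 1 = 2 := rfl
  have s10 : (1 : Fin 3).succAbove 0 = 0 := rfl
  have s11 : (1 : Fin 3).succAbove 1 = 2 := rfl
  have s20 : (2 : Fin 3).succAbove 0 = 0 := rfl
  have s21 : (2 : Fin 3).succAbove 1 = 1 := rfl
  rw [c₁, c₂, c₁₂, extDeriv2]
  simp only [fderiv_C22 hh₁ hh₂, w₁, w₂, Fin.sum_univ_three, s00, s01, s10, s11, s20, s21]
  generalize h₁⁻¹ * (v 0).1 = a₀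
  generalize h₁⁻¹ * (v 1).1 = a₁
  generalize h₁⁻¹ * (v 2).1 = a₂
  generalize (v 0).2 * h₂⁻¹ = b₀
  generalize (v 1).2 * h₂⁻¹ = b₁
  generalize (v 2).2 * h₂⁻¹ = b₂
  have rot : ∀ x y z : M2, (x * y * z).trace = (z * x * y).trace :=
    fun x y z => by rw [Matrix.trace_mul_comm, mul_assoc]
  have ra : ∀ x y : M2, (x * a₀ * y).trace = (a₀ * y * x).trace := fun x y => (rot a₀ y x).symm
  have ra' : ∀ x y : M2, (x * y * a₀).trace = (a₀ * x * y).trace := fun x y => rot x y a₀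
  have rb : ∀ x y : M2, (x * b₀ * y).trace = (b₀ * y * x).trace := fun x y => (rot b₀ y x).symm
  have rb' : ∀ x y : M2, (x * y * b₀).trace = (b₀ * x * y).trace := fun x y => rot x y b₀
  simp only [mul_add, add_mul, Matrix.trace_add, ra, ra', rb, rb']
  norm_num
  ring

/-- On `SU(2)` the 3-form `C_{1,3}` is closed, and on `SU(2) × SU(2)` the
Polyakov–Wiegmann type identity `ε₀*C_{1,3} − ε₁*C_{1,3} + ε₂*C_{1,3} + dC_{2,2} = 0`
holds, where the nerve face maps are `ε₀(h₁,h₂) = h₂`, `ε₁(h₁,h₂) = h₁h₂`,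
`ε₂(h₁,h₂) = h₁` (so the differential of `ε₁` sends `(v₁, v₂)` to `v₁h₂ + h₁v₂`);
these are the first two cocycle conditions in the total complex of the simplicial
de Rham double complex of `N SU(2)`, whose total 4-cocycle represents the second
Chern class. -/
theorem C13_closed_and_polyakovWiegmann :
    (∀ h : M2, h ∈ Matrix.specialUnitaryGroup (Fin 2) ℂ →
      ∀ v : Fin 4 → M2, (∀ i, suTangent h (v i)) → extDeriv3 C13 h v = 0) ∧
    (∀ h₁ h₂ : M2, h₁ ∈ Matrix.specialUnitaryGroup (Fin 2) ℂ →
      h₂ ∈ Matrix.specialUnitaryGroup (Fin 2) ℂ →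
      ∀ v : Fin 3 → M2 × M2, (∀ i, suTangent h₁ (v i).1 ∧ suTangent h₂ (v i).2) →
        C13 h₂ (fun i => (v i).2)
          - C13 (h₁ * h₂) (fun i => (v i).1 * h₂ + h₁ * (v i).2)
          + C13 h₁ (fun i => (v i).1)
          + extDeriv2 C22 (h₁, h₂) v = 0) := by
  have hunit : ∀ h : M2, h ∈ Matrix.specialUnitaryGroup (Fin 2) ℂ → IsUnit h := fun h hh => by
    rw [Matrix.isUnit_iff_isUnit_det, (Matrix.mem_specialUnitaryGroup_iff.1 hh).2]
    exact isUnit_one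
  exact ⟨fun h hh v _ => extDeriv3_C13 (hunit h hh) v,
    fun h₁ h₂ hh₁ hh₂ v _ => polyakovWiegmann (hunit h₁ hh₁) (hunit h₂ hh₂) v⟩
end
end

section
/- On SU(2) × SU(2) × SU(2), the 2-form C_{2,2} = (1/(2πi))² · (1/2) · tr(h₂⁻¹ h₁⁻¹ dh₁ dh₂) on SU(2) × SU(2) satisfies the simplicial cocycle condition ε₀*C_{2,2} − ε₁*C_{2,2} + ε₂*C_{2,2} − ε₃*C_{2,2} = 0. -/
/-! The simplicial cocycle condition for the 2-form `C_{2,2}` on `SU(2) × SU(2)`.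
Since `SU(2)` is an embedded submanifold of the vector space `M₂(ℂ)`, a differential
form on `SU(2)²` given by a global matrix formula is formalized as the pointwise
formula evaluated at points of `SU(2)²` on tangent vectors `v` with `h⁻¹v ∈ 𝔰𝔲(2)`
in each component. -/

noncomputable section

/-- The bilinear cocycle identity behind `C22_simplicial_cocycle`; antisymmetrizing it in
`v` and `w` gives the statement about the 2-form. -/
theorem trace_inv_mul_cocycle (h₁ h₂ h₃ : M2) (hd₁ : IsUnit h₁.det) (hd₃ : IsUnit h₃.det)
    (v₁ v₂ w₂ w₃ : M2) :
    (h₃⁻¹ * h₂⁻¹ * v₂ * w₃).trace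
      - (h₃⁻¹ * (h₁ * h₂)⁻¹ * (v₁ * h₂ + h₁ * v₂) * w₃).trace
      + ((h₂ * h₃)⁻¹ * h₁⁻¹ * v₁ * (w₂ * h₃ + h₂ * w₃)).trace
      - (h₂⁻¹ * h₁⁻¹ * v₁ * w₂).trace = 0 := by
  have hcancel : h₃⁻¹ * (h₁ * h₂)⁻¹ * (v₁ * h₂ + h₁ * v₂) * w₃
      = h₃⁻¹ * h₂⁻¹ * h₁⁻¹ * v₁ * h₂ * w₃ + h₃⁻¹ * h₂⁻¹ * v₂ * w₃ := by
    simp only [Matrix.mul_inv_rev, mul_add, add_mul, mul_assoc,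
      Matrix.nonsing_inv_mul_cancel_left _ _ hd₁]
  have hcyclic : (h₃⁻¹ * h₂⁻¹ * h₁⁻¹ * v₁ * w₂ * h₃).trace
      = (h₂⁻¹ * h₁⁻¹ * v₁ * w₂).trace := by
    rw [Matrix.trace_mul_comm]
    simp only [mul_assoc, Matrix.mul_nonsing_inv_cancel_left _ _ hd₃]
  rw [hcancel, Matrix.mul_inv_rev, mul_add, Matrix.trace_add, Matrix.trace_add, ← hcyclic]
  simp only [mul_assoc]
  ring

/-- On `SU(2)³` the 2-form `C_{2,2}` satisfies the simplicial cocycle condition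
`ε₀*C_{2,2} − ε₁*C_{2,2} + ε₂*C_{2,2} − ε₃*C_{2,2} = 0`, where the nerve face maps are
`ε₀(h₁,h₂,h₃) = (h₂,h₃)`, `ε₁(h₁,h₂,h₃) = (h₁h₂,h₃)`, `ε₂(h₁,h₂,h₃) = (h₁,h₂h₃)`,
`ε₃(h₁,h₂,h₃) = (h₁,h₂)` (their differentials act accordingly on tangent vectors,
e.g. `dε₁(v₁,v₂,v₃) = (v₁h₂ + h₁v₂, v₃)`). -/
theorem C22_simplicial_cocycle
    (h₁ h₂ h₃ : M2)
    (hh₁ : h₁ ∈ Matrix.specialUnitaryGroup (Fin 2) ℂ)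
    (hh₂ : h₂ ∈ Matrix.specialUnitaryGroup (Fin 2) ℂ)
    (hh₃ : h₃ ∈ Matrix.specialUnitaryGroup (Fin 2) ℂ)
    (v₁ v₂ v₃ w₁ w₂ w₃ : M2)
    (hv₁ : suTangent h₁ v₁) (hv₂ : suTangent h₂ v₂) (hv₃ : suTangent h₃ v₃)
    (hw₁ : suTangent h₁ w₁) (hw₂ : suTangent h₂ w₂) (hw₃ : suTangent h₃ w₃) :
    C22 (h₂, h₃) (v₂, v₃) (w₂, w₃)
      - C22 (h₁ * h₂, h₃) (v₁ * h₂ + h₁ * v₂, v₃) (w₁ * h₂ + h₁ * w₂, w₃)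
      + C22 (h₁, h₂ * h₃) (v₁, v₂ * h₃ + h₂ * v₃) (w₁, w₂ * h₃ + h₂ * w₃)
      - C22 (h₁, h₂) (v₁, v₂) (w₁, w₂) = 0 := by
  have hd₁ : IsUnit h₁.det := by
    simp [(Matrix.mem_specialUnitaryGroup_iff.mp hh₁).2]
  have hd₃ : IsUnit h₃.det := by
    simp [(Matrix.mem_specialUnitaryGroup_iff.mp hh₃).2]
  simp only [C22]
  linear_combination (1 / (2 * Real.pi * Complex.I)) ^ 2 * (1 / 2) *
    (trace_inv_mul_cocycle h₁ h₂ h₃ hd₁ hd₃ v₁ v₂ w₂ w₃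
      - trace_inv_mul_cocycle h₁ h₂ h₃ hd₁ hd₃ w₁ w₂ v₂ v₃)
end
end

section
/- On U(2) × U(2) × U(2), the 2-form C^U_{2,2} = (1/(2πi))² · (1/2) · tr(h₂⁻¹ h₁⁻¹ dh₁ dh₂) − (1/(2πi))² · (1/2) · tr(h₁⁻¹ dh₁) tr(h₂⁻¹ dh₂) on U(2) × U(2) satisfies the simplicial cocycle condition ε₀*C^U_{2,2} − ε₁*C^U_{2,2} + ε₂*C^U_{2,2} − ε₃*C^U_{2,2} = 0. -/
/-! The simplicial cocycle condition for the 2-form `C^U_{2,2}` on `U(2) × U(2)`.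
Since `U(2)` is an embedded submanifold of the vector space `M₂(ℂ)`, a differential
form on `U(2)²` given by a global matrix formula is formalized as the pointwise
formula evaluated at points of `U(2)²` on tangent vectors `v` with `h⁻¹v ∈ 𝔲(2)`
(anti-Hermitian) in each component. -/

noncomputable section

/-- `v` is tangent to `U(2)` at `h`: `h⁻¹v` is anti-Hermitian. -/
def uTangent (h v : M2) : Prop :=
  star (h⁻¹ * v) = -(h⁻¹ * v)

/-- The 2-form
`C^U_{2,2} = (1/(2πi))² ⬝ (1/2) ⬝ tr(h₂⁻¹h₁⁻¹ dh₁ dh₂)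
             − (1/(2πi))² ⬝ (1/2) ⬝ tr(h₁⁻¹dh₁) tr(h₂⁻¹dh₂)`
on `U(2) × U(2)`, evaluated at `(h₁, h₂)` on tangent vectors `v, w`. -/
def C22U (h : M2 × M2) (v w : M2 × M2) : ℂ :=
  (1 / (2 * Real.pi * Complex.I)) ^ 2 * (1 / 2) *
    ((h.2⁻¹ * h.1⁻¹ * v.1 * w.2).trace - (h.2⁻¹ * h.1⁻¹ * w.1 * v.2).trace)
  - (1 / (2 * Real.pi * Complex.I)) ^ 2 * (1 / 2) *
    ((h.1⁻¹ * v.1).trace * (h.2⁻¹ * w.2).trace -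
      (h.1⁻¹ * w.1).trace * (h.2⁻¹ * v.2).trace)

open Matrix in
/-- Simplicial cocycle identity for `tr(h₂⁻¹h₁⁻¹ dh₁ ⊗ dh₂)`. -/
theorem trace_inv_mul_inv_cocycle {n R : Type*} [Fintype n] [DecidableEq n] [CommRing R]
    {h₁ h₂ h₃ : Matrix n n R} (hd₁ : IsUnit h₁.det) (hd₃ : IsUnit h₃.det)
    (v₁ v₂ w₂ w₃ : Matrix n n R) :
    (h₃⁻¹ * h₂⁻¹ * v₂ * w₃).trace
      - (h₃⁻¹ * (h₁ * h₂)⁻¹ * (v₁ * h₂ + h₁ * v₂) * w₃).trace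
      + ((h₂ * h₃)⁻¹ * h₁⁻¹ * v₁ * (w₂ * h₃ + h₂ * w₃)).trace
      - (h₂⁻¹ * h₁⁻¹ * v₁ * w₂).trace = 0 := by
  have hcyc : (h₃⁻¹ * (h₂⁻¹ * (h₁⁻¹ * (v₁ * (w₂ * h₃))))).trace
      = (h₂⁻¹ * (h₁⁻¹ * (v₁ * w₂))).trace := by
    rw [trace_mul_comm]
    simp only [Matrix.mul_assoc, mul_nonsing_inv _ hd₃, Matrix.mul_one]
  simp only [Matrix.mul_inv_rev, Matrix.mul_add, Matrix.add_mul, trace_add, Matrix.mul_assoc,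
    nonsing_inv_mul_cancel_left _ _ hd₁, hcyc]
  ring

open Matrix in
/-- The form `tr(h⁻¹ dh)` is additive under multiplication. -/
theorem trace_inv_mul_leibniz {n R : Type*} [Fintype n] [DecidableEq n] [CommRing R]
    {g h : Matrix n n R} (hg : IsUnit g.det) (hh : IsUnit h.det) (v w : Matrix n n R) :
    ((g * h)⁻¹ * (v * h + g * w)).trace = (g⁻¹ * v).trace + (h⁻¹ * w).trace := by
  have hcyc : (h⁻¹ * (g⁻¹ * (v * h))).trace = (g⁻¹ * v).trace := by
    rw [trace_mul_comm]
    simp only [Matrix.mul_assoc, mul_nonsing_inv _ hh, Matrix.mul_one]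
  simp only [Matrix.mul_inv_rev, Matrix.mul_add, trace_add, Matrix.mul_assoc,
    nonsing_inv_mul_cancel_left _ _ hg, hcyc]

/-- On `U(2)³` the 2-form `C^U_{2,2}` satisfies the simplicial cocycle condition
`ε₀*C^U_{2,2} − ε₁*C^U_{2,2} + ε₂*C^U_{2,2} − ε₃*C^U_{2,2} = 0`, where the nerve face
maps are `ε₀(h₁,h₂,h₃) = (h₂,h₃)`, `ε₁(h₁,h₂,h₃) = (h₁h₂,h₃)`,
`ε₂(h₁,h₂,h₃) = (h₁,h₂h₃)`, `ε₃(h₁,h₂,h₃) = (h₁,h₂)` (their differentials act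
accordingly on tangent vectors, e.g. `dε₁(v₁,v₂,v₃) = (v₁h₂ + h₁v₂, v₃)`). -/
theorem C22U_simplicial_cocycle
    (h₁ h₂ h₃ : M2)
    (hh₁ : h₁ ∈ Matrix.unitaryGroup (Fin 2) ℂ)
    (hh₂ : h₂ ∈ Matrix.unitaryGroup (Fin 2) ℂ)
    (hh₃ : h₃ ∈ Matrix.unitaryGroup (Fin 2) ℂ)
    (v₁ v₂ v₃ w₁ w₂ w₃ : M2)
    (hv₁ : uTangent h₁ v₁) (hv₂ : uTangent h₂ v₂) (hv₃ : uTangent h₃ v₃)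
    (hw₁ : uTangent h₁ w₁) (hw₂ : uTangent h₂ w₂) (hw₃ : uTangent h₃ w₃) :
    C22U (h₂, h₃) (v₂, v₃) (w₂, w₃)
      - C22U (h₁ * h₂, h₃) (v₁ * h₂ + h₁ * v₂, v₃) (w₁ * h₂ + h₁ * w₂, w₃)
      + C22U (h₁, h₂ * h₃) (v₁, v₂ * h₃ + h₂ * v₃) (w₁, w₂ * h₃ + h₂ * w₃)
      - C22U (h₁, h₂) (v₁, v₂) (w₁, w₂) = 0 := by
  have hd : ∀ {h : M2}, h ∈ Matrix.unitaryGroup (Fin 2) ℂ → IsUnit h.det := fun hh =>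
    Matrix.isUnit_det_of_left_inverse (Matrix.mem_unitaryGroup_iff'.mp hh)
  have hvw := trace_inv_mul_inv_cocycle (h₂ := h₂) (hd hh₁) (hd hh₃) v₁ v₂ w₂ w₃
  have hwv := trace_inv_mul_inv_cocycle (h₂ := h₂) (hd hh₁) (hd hh₃) w₁ w₂ v₂ v₃
  simp only [C22U, trace_inv_mul_leibniz (hd hh₁) (hd hh₂),
    trace_inv_mul_leibniz (hd hh₂) (hd hh₃)]
  linear_combination (1 / (2 * Real.pi * Complex.I)) ^ 2 * (1 / 2) * (hvw - hwv)
end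
end

section
/- For each n ∈ ℤ, let λ_n ∈ L U(2) be the loop λ_n(e^{is}) = diag(1, e^{ins}), let L U(2)_n be the path component of λ_n in L U(2), and let ψ_n : S¹ → L U(2)_n be the loop based at λ_n defined by ψ_n(e^{it}) = (e^{is} ↦ diag(1, e^{i(ns+t)})). Then the fundamental group π₁(L U(2)_n, λ_n) is infinite cyclic, generated by the homotopy class of ψ_n. -/
open Matrix

noncomputable def u2diag (w : Circle) : Matrix.unitaryGroup (Fin 2) ℂ :=
  ⟨Matrix.diagonal ![1, (w : ℂ)], by
    have h : (fun i => ![1, (w : ℂ)] i * star (![1, (w : ℂ)] i)) = fun _ => (1 : ℂ) := by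
      funext i
      fin_cases i
      · simp
      · simp [Complex.mul_conj]
    rw [Matrix.mem_unitaryGroup_iff, Matrix.star_eq_conjTranspose,
      Matrix.diagonal_conjTranspose, Matrix.diagonal_mul_diagonal]
    simp only [Pi.star_apply] at h ⊢
    rw [h, Matrix.diagonal_one]⟩

lemma continuous_u2diag : Continuous u2diag := by
  apply Continuous.subtype_mk
  apply continuous_matrix
  intro i j
  fin_cases i <;> fin_cases j <;>
    simp only [Matrix.diagonal_apply] <;> simp <;> fun_prop

/-- The loop `λ_n ∈ L U(2)`, `λ_n(z) = diag(1, z^n)`. -/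
noncomputable def lam (n : ℤ) : C(Circle, Matrix.unitaryGroup (Fin 2) ℂ) :=
  ⟨fun z => u2diag (z ^ n), continuous_u2diag.comp (continuous_zpow n)⟩

/-- The family of loops `r ↦ (z ↦ diag(1, z^n e^{2πir}))`, as a continuous map
`ℝ → L U(2)`; its restriction to `[0,1]` is the loop `ψ_n` based at `λ_n`. -/
noncomputable def psiFam (n : ℤ) : C(ℝ, C(Circle, Matrix.unitaryGroup (Fin 2) ℂ)) :=
  ContinuousMap.curry
    ⟨fun p => u2diag (p.2 ^ n * Circle.exp (2 * Real.pi * p.1)),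
     continuous_u2diag.comp
       (((continuous_zpow n).comp continuous_snd).mul
         (Circle.exp.continuous.comp (continuous_const.mul continuous_fst)))⟩

lemma psiFam_zero (n : ℤ) : psiFam n 0 = lam n :=
  ContinuousMap.ext fun z => show u2diag (z ^ n * Circle.exp (2 * Real.pi * 0)) = u2diag (z ^ n)
    by rw [mul_zero, Circle.exp_zero, mul_one]

lemma psiFam_one (n : ℤ) : psiFam n 1 = lam n :=
  ContinuousMap.ext fun z => show u2diag (z ^ n * Circle.exp (2 * Real.pi * 1)) = u2diag (z ^ n)
    by rw [mul_one, Circle.exp_two_pi, mul_one]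

lemma psiFam_mem (n : ℤ) (t : ℝ) : psiFam n t ∈ pathComponent (lam n) := by
  refine ⟨{ toFun := fun s => psiFam n ((s : ℝ) * t)
            continuous_toFun := (psiFam n).continuous.comp (continuous_subtype_val.mul continuous_const)
            source' := by simp [psiFam_zero]
            target' := by simp }⟩

/-- `λ_n` as a point of its own path component `L U(2)_n`. -/
noncomputable def lamPt (n : ℤ) : pathComponent (lam n) := ⟨lam n, mem_pathComponent_self _⟩

/-- The loop `ψ_n : t ↦ (z ↦ diag(1, z^n e^{2πit}))` in the path component `L U(2)_n`,
based at `λ_n`. -/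
noncomputable def psiLoop (n : ℤ) : Path (lamPt n) (lamPt n) where
  toFun t := ⟨psiFam n t, psiFam_mem n t⟩
  continuous_toFun := Continuous.subtype_mk ((psiFam n).continuous.comp continuous_subtype_val) _
  source' := Subtype.ext (psiFam_zero n)
  target' := Subtype.ext (psiFam_one n)

/-- The class of `ψ_n` in the fundamental group `π₁(L U(2)_n, λ_n)`. -/
noncomputable def psiClass (n : ℤ) : FundamentalGroup (pathComponent (lam n)) (lamPt n) :=
  FundamentalGroup.fromPath (X := TopCat.of (pathComponent (lam n))) ⟦psiLoop n⟧

section SphereHomotopy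

open Metric unitInterval Manifold

variable {X E : Type*} [TopologicalSpace X] [NormedAddCommGroup E] [InnerProductSpace ℝ E]

lemma inv_norm_smul_mem_unitSphere {v : E} (hv : v ≠ 0) : ‖v‖⁻¹ • v ∈ sphere (0 : E) 1 := by
  simp [norm_smul, hv]

/-- The radial projection to the unit sphere of a nowhere vanishing continuous map. -/
noncomputable def sphereNormalize (F : C(X, E)) (hF : ∀ x, F x ≠ 0) : C(X, sphere (0 : E) 1) where
  toFun x := ⟨‖F x‖⁻¹ • F x, inv_norm_smul_mem_unitSphere (hF x)⟩
  continuous_toFun := Continuous.subtype_mk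
    ((F.continuous.norm.inv₀ fun x => norm_ne_zero_iff.2 (hF x)).smul F.continuous)
    fun x => inv_norm_smul_mem_unitSphere (hF x)

lemma sphereNormalize_eq_of_eq {F : C(X, E)} (hF : ∀ x, F x ≠ 0) {x : X} {v : sphere (0 : E) 1}
    (h : F x = v) : sphereNormalize F hF x = v := by
  apply Subtype.ext
  simp [sphereNormalize, h]

lemma homotopicRel_sphereNormalize {f : C(X, sphere (0 : E) 1)} {K : C(X, E)}
    (hK : ∀ x, K x ≠ 0) (hfK : ∀ x, ‖K x - f x‖ < 1) {S : Set X} (hS : ∀ x ∈ S, K x = f x) :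
    f.HomotopicRel (sphereNormalize K hK) S := by
  have hN : ∀ p : I × X, (f p.2 : E) + (p.1 : ℝ) • (K p.2 - f p.2) ≠ 0 := by
    rintro ⟨s, x⟩ h
    have h1 : ‖(s : ℝ) • (K x - f x)‖ = 1 := by
      rw [← neg_eq_of_add_eq_zero_right h, norm_neg]
      simp
    rw [norm_smul, Real.norm_of_nonneg s.2.1] at h1
    nlinarith [hfK x, s.2.2, s.2.1, norm_nonneg (K x - f x)]
  refine ⟨⟨⟨sphereNormalize ⟨fun p : I × X => (f p.2 : E) + (p.1 : ℝ) • (K p.2 - f p.2),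
    by fun_prop⟩ hN, fun x => ?_, fun x => ?_⟩, fun s x hx => ?_⟩⟩
  · exact sphereNormalize_eq_of_eq hN (by simp)
  · apply Subtype.ext
    simp [sphereNormalize, -smul_add]
  · exact sphereNormalize_eq_of_eq hN (by simp [hS x hx])

/-- Maps into a sphere minus a point are homotopic relative to any set where they agree. -/
lemma homotopicRel_of_forall_ne {f g : C(X, sphere (0 : E) 1)} {v : sphere (0 : E) 1}
    (hf : ∀ x, f x ≠ v) (hg : ∀ x, g x ≠ v) {S : Set X} (hS : ∀ x ∈ S, f x = g x) :
    f.HomotopicRel g S := by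
  have hv : ‖(v : E)‖ = 1 := by simp
  let φ := stereographic hv
  have hsrc : ∀ y : sphere (0 : E) 1, y ≠ v → y ∈ φ.source := fun y hy => by
    simpa [φ] using hy
  have hc : ∀ k : C(X, sphere (0 : E) 1), (∀ x, k x ≠ v) → Continuous fun x => φ (k x) :=
    fun k hk => φ.continuousOn.comp_continuous k.continuous fun x => hsrc _ (hk x)
  have hsymm : Continuous φ.symm := by
    have := φ.continuousOn_symm
    rwa [show φ.target = Set.univ from stereographic_target hv, continuousOn_univ] at this
  have hf' := hc f hf
  have hg' := hc g hg
  refine ⟨⟨⟨⟨fun p : I × X => φ.symm (φ (f p.2) + (p.1 : ℝ) • (φ (g p.2) - φ (f p.2))),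
    hsymm.comp ((hf'.comp continuous_snd).add ((continuous_subtype_val.comp continuous_fst).smul
      ((hg'.comp continuous_snd).sub (hf'.comp continuous_snd))))⟩, fun x => ?_, fun x => ?_⟩, fun s x hx => ?_⟩⟩
  · simpa using φ.left_inv (hsrc _ (hf x))
  · simpa using φ.left_inv (hsrc _ (hg x))
  · simpa [hS x hx] using φ.left_inv (hsrc _ (hg x))

lemma exists_contMDiff_cylinder_approx [FiniteDimensional ℝ E]
    (f : C(I × Circle, E)) (e : E) (h0 : ∀ z, f (0, z) = e) (h1 : ∀ z, f (1, z) = e) :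
    ∃ K : ℝ × Circle → E, ContMDiff (𝓘(ℝ, ℝ).prod (𝓡 1)) 𝓘(ℝ, E) 1 K ∧
      (∀ z, K (0, z) = e) ∧ (∀ z, K (1, z) = e) ∧
      ∀ (t : I) z, ‖K (t, z) - f (t, z)‖ < 1 := by
  obtain ⟨g, hg, -⟩ := Continuous.exists_contMDiff_approx (𝓘(ℝ, ℝ).prod (𝓡 1)) 1
    (f := fun p : ℝ × Circle => f (Set.projIcc 0 1 zero_le_one p.1, p.2))
    (ε := fun _ => 1 / 2) (by fun_prop) continuous_const (by norm_num)
  have hgs (c : ℝ) : ContMDiff (𝓘(ℝ, ℝ).prod (𝓡 1)) 𝓘(ℝ, E) 1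
      fun p : ℝ × Circle => g (c, p.2) :=
    g.contMDiff.comp (contMDiff_const.prodMk contMDiff_snd)
  have hfst : ContMDiff (𝓘(ℝ, ℝ).prod (𝓡 1)) 𝓘(ℝ, ℝ) 1 (fun p : ℝ × Circle => p.1) :=
    contMDiff_fst
  refine ⟨fun p => g p - ((1 - p.1) • (g (0, p.2) - e) + p.1 • (g (1, p.2) - e)), ?_, ?_, ?_, ?_⟩
  · exact g.contMDiff.sub ((((contMDiff_const.sub hfst)).smul ((hgs 0).sub contMDiff_const)).add
      (hfst.smul ((hgs 1).sub contMDiff_const)))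
  · intro z; simp
  · intro z; simp
  · intro t z
    have a := hg (t, z)
    have b := hg (0, z)
    have c := hg (1, z)
    simp only [Set.projIcc_val, Set.projIcc_left, Set.projIcc_right, dist_eq_norm] at a b c
    rw [show (⟨0, _⟩ : I) = 0 from rfl, h0] at b
    rw [show (⟨1, _⟩ : I) = 1 from rfl, h1] at c
    have ht0 := t.2.1
    have ht1 := t.2.2
    calc _ = ‖(g (t, z) - f (t, z)) - ((1 - (t : ℝ)) • (g (0, z) - e)
            + (t : ℝ) • (g (1, z) - e))‖ := by rw [sub_right_comm]
      _ ≤ ‖g (t, z) - f (t, z)‖ + (‖(1 - (t : ℝ)) • (g (0, z) - e)‖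
            + ‖(t : ℝ) • (g (1, z) - e)‖) :=
          (norm_sub_le _ _).trans (by gcongr; exact norm_add_le _ _)
      _ = ‖g (t, z) - f (t, z)‖ + ((1 - (t : ℝ)) * ‖g (0, z) - e‖
            + t * ‖g (1, z) - e‖) := by
          rw [norm_smul, norm_smul, Real.norm_of_nonneg ht0, Real.norm_of_nonneg (by linarith)]
      _ < 1 := by nlinarith

/-- A family of loops in a sphere of dimension at least three that is constant at both ends of
the cylinder contracts relative to these ends. -/
theorem homotopicRel_const_of_cylinder [FiniteDimensional ℝ E] (hE : 3 < Module.finrank ℝ E)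
    (f : C(I × Circle, sphere (0 : E) 1)) (e : sphere (0 : E) 1)
    (h0 : ∀ z, f (0, z) = e) (h1 : ∀ z, f (1, z) = e) :
    f.HomotopicRel (ContinuousMap.const _ e) {p | p.1 = 0 ∨ p.1 = 1} := by
  obtain ⟨K, hK, hK0, hK1, hKf⟩ := exists_contMDiff_cylinder_approx
    (⟨fun p => (f p : E), by fun_prop⟩ : C(I × Circle, E)) e (fun z => by simp [h0])
    (fun z => by simp [h1])
  have hKc := hK.continuous
  let k : C(I × Circle, E) := ⟨fun p => K (p.1, p.2), by fun_prop⟩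
  have hk0 : ∀ p, k p ≠ 0 := by
    intro p hp
    have := hKf p.1 p.2
    simp [show K (p.1, p.2) = 0 from hp] at this
  have hsmooth : ContDiff ℝ 1 fun q : ℝ × ℝ × ℝ => q.1 • K (q.2.1, Circle.exp q.2.2) := by
    refine contDiff_fst.smul (ContMDiff.contDiff ?_)
    exact hK.comp ((contDiff_fst.comp contDiff_snd).contMDiff.prodMk
      (contMDiff_circleExp.comp (contDiff_snd.comp contDiff_snd).contMDiff))
  have hdense := hsmooth.dense_compl_range_of_finrank_lt_finrank (by simpa using hE)
  obtain ⟨v, hv⟩ := hdense.nonempty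
  have hv' : ∀ (r t : ℝ) z, r • K (t, z) ≠ v := fun r t z h =>
    hv ⟨(r, t, (z : ℂ).arg), by simpa using h⟩
  have hv0 : v ≠ 0 := fun h => hv' 0 0 1 (by simp [h])
  let w : sphere (0 : E) 1 := ⟨‖v‖⁻¹ • v, inv_norm_smul_mem_unitSphere hv0⟩
  have hkw : ∀ p, sphereNormalize k hk0 p ≠ w := by
    intro p hp
    have h := congrArg Subtype.val hp
    simp only [sphereNormalize, ContinuousMap.coe_mk, w] at h
    apply hv' (‖v‖ * ‖k p‖⁻¹) p.1 p.2
    rw [mul_smul]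
    change ‖v‖ • (‖k p‖⁻¹ • k p) = v
    rw [h, smul_inv_smul₀ (norm_ne_zero_iff.2 hv0)]
  have hend : ∀ p ∈ {p : I × Circle | p.1 = 0 ∨ p.1 = 1}, k p = e ∧ f p = e := by
    rintro ⟨t, z⟩ (rfl | rfl)
    · exact ⟨hK0 z, h0 z⟩
    · exact ⟨hK1 z, h1 z⟩
  have hew : e ≠ w := fun h => hkw (0, 1)
    ((sphereNormalize_eq_of_eq hk0 (hend (0, 1) (Or.inl rfl)).1).trans h)
  refine (homotopicRel_sphereNormalize hk0 (fun p => hKf p.1 p.2) fun p hp => ?_).trans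
    (homotopicRel_of_forall_ne hkw (fun _ => hew) fun p hp => ?_)
  · rw [(hend p hp).1, (hend p hp).2]
  · exact sphereNormalize_eq_of_eq hk0 (hend p hp).1

end SphereHomotopy

section UnitaryCoordinates

open Metric ComplexConjugate

lemma row_mul_conj_of_mem_unitaryGroup (u : Matrix.unitaryGroup (Fin 2) ℂ) :
    u.1 0 0 * conj (u.1 0 0) + u.1 0 1 * conj (u.1 0 1) = 1 := by
  have h := congrFun₂ (Matrix.mem_unitaryGroup_iff.1 u.2) 0 0
  simpa [Matrix.mul_apply, Fin.sum_univ_two] using h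

lemma continuous_unitaryGroup_entry (i j : Fin 2) :
    Continuous fun u : Matrix.unitaryGroup (Fin 2) ℂ => u.1 i j :=
  continuous_subtype_val.matrix_elem i j

lemma u2Row_mem (u : Matrix.unitaryGroup (Fin 2) ℂ) :
    !₂[(u.1 0 0).re, (u.1 0 0).im, (u.1 0 1).re, (u.1 0 1).im] ∈
      sphere (0 : EuclideanSpace ℝ (Fin 4)) 1 := by
  have h := congrArg Complex.re (row_mul_conj_of_mem_unitaryGroup u)
  simp [EuclideanSpace.sphere_zero_eq, Fin.sum_univ_four] at h ⊢
  linarith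

/-- The first row of a unitary `2 × 2` matrix, as a point of the unit sphere of `ℝ⁴`. -/
noncomputable def u2Row :
    C(Matrix.unitaryGroup (Fin 2) ℂ, sphere (0 : EuclideanSpace ℝ (Fin 4)) 1) where
  toFun u := ⟨!₂[(u.1 0 0).re, (u.1 0 0).im, (u.1 0 1).re, (u.1 0 1).im], u2Row_mem u⟩
  continuous_toFun := by
    have h := continuous_unitaryGroup_entry
    have hre := fun i j => Complex.continuous_re.comp (h i j)
    have him := fun i j => Complex.continuous_im.comp (h i j)
    refine Continuous.subtype_mk ((PiLp.continuous_toLp 2 _).comp (continuous_pi fun i => ?_)) _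
    fin_cases i
    exacts [hre 0 0, him 0 0, hre 0 1, him 0 1]

lemma u2Det_mem (u : Matrix.unitaryGroup (Fin 2) ℂ) : u.1.det ∈ Submonoid.unitSphere ℂ :=
  mem_sphere_zero_iff_norm.2 (CStarRing.norm_of_mem_unitary (Matrix.det_of_mem_unitary u.2))

/-- The determinant of a unitary `2 × 2` matrix, as a point of the circle. -/
noncomputable def u2Det : C(Matrix.unitaryGroup (Fin 2) ℂ, Circle) where
  toFun u := ⟨u.1.det, u2Det_mem u⟩
  continuous_toFun := continuous_subtype_val.matrix_det.subtype_mk _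

lemma coe_u2Det (u : Matrix.unitaryGroup (Fin 2) ℂ) : (u2Det u : ℂ) = u.1.det := rfl

lemma u2Mk_mem (p : sphere (0 : EuclideanSpace ℝ (Fin 4)) 1 × Circle) :
    (!![⟨p.1.1 0, p.1.1 1⟩, ⟨p.1.1 2, p.1.1 3⟩; -(p.2 * conj ⟨p.1.1 2, p.1.1 3⟩),
      p.2 * conj ⟨p.1.1 0, p.1.1 1⟩] : Matrix (Fin 2) (Fin 2) ℂ) ∈
      Matrix.unitaryGroup (Fin 2) ℂ := by
  obtain ⟨⟨q, hq⟩, w⟩ := p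
  have hw : (w : ℂ) * conj (w : ℂ) = 1 := by simp [Complex.mul_conj]
  rw [EuclideanSpace.sphere_zero_eq _ zero_le_one] at hq
  simp only [Set.mem_ofPred_eq, Fin.sum_univ_four] at hq
  have hab : (⟨q 0, q 1⟩ : ℂ) * conj ⟨q 0, q 1⟩ + (⟨q 2, q 3⟩ : ℂ) * conj ⟨q 2, q 3⟩ = 1 := by
    apply Complex.ext <;> simp <;> linarith
  generalize (⟨q 0, q 1⟩ : ℂ) = a at *
  generalize (⟨q 2, q 3⟩ : ℂ) = b at *
  rw [Matrix.mem_unitaryGroup_iff]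
  ext i j
  fin_cases i <;> fin_cases j <;> simp [Matrix.mul_apply, Fin.sum_univ_two]
  · linear_combination hab
  · ring
  · ring
  · linear_combination hw * (a * conj a + b * conj b) + hab

/-- The unitary `2 × 2` matrix with prescribed first row and determinant. -/
noncomputable def u2Mk : C(sphere (0 : EuclideanSpace ℝ (Fin 4)) 1 × Circle,
    Matrix.unitaryGroup (Fin 2) ℂ) where
  toFun p := ⟨_, u2Mk_mem p⟩
  continuous_toFun := by
    refine Continuous.subtype_mk (continuous_matrix fun i j => ?_) _
    fin_cases i <;> fin_cases j <;> simp [Complex.mk_eq_add_mul_I] <;> fun_prop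

lemma u2Mk_row_det (u : Matrix.unitaryGroup (Fin 2) ℂ) : u2Mk (u2Row u, u2Det u) = u := by
  have h00 := row_mul_conj_of_mem_unitaryGroup u
  have h10 := congrFun₂ (Matrix.mem_unitaryGroup_iff.1 u.2) 1 0
  simp [Matrix.mul_apply, Fin.sum_univ_two] at h10
  apply Subtype.ext
  ext i j
  fin_cases i <;> fin_cases j <;> simp [u2Mk, u2Row, coe_u2Det, Matrix.det_fin_two]
  · linear_combination (u.1 1 0) * h00 - (u.1 0 0) * h10
  · linear_combination (u.1 1 1) * h00 - (u.1 0 1) * h10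

lemma rowOne_mem :
    EuclideanSpace.single 0 1 ∈ sphere (0 : EuclideanSpace ℝ (Fin 4)) 1 := by
  simp

/-- The first row of the identity matrix, as a point of the unit sphere of `ℝ⁴`. -/
noncomputable def rowOne : sphere (0 : EuclideanSpace ℝ (Fin 4)) 1 := ⟨_, rowOne_mem⟩

lemma u2Row_u2diag (w : Circle) : u2Row (u2diag w) = rowOne := by
  apply Subtype.ext
  ext i
  fin_cases i <;> simp [u2Row, rowOne, u2diag]

lemma u2Det_u2diag (w : Circle) : u2Det (u2diag w) = w := by
  apply Circle.ext
  simp [coe_u2Det, u2diag]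

lemma u2Mk_one (w : Circle) : u2Mk (rowOne, w) = u2diag w := by
  simpa only [u2Row_u2diag, u2Det_u2diag] using u2Mk_row_det (u2diag w)

end UnitaryCoordinates

section LoopComponent

open unitInterval

/-- The family `psiFam n` as a map into the path component of `lam n`. -/
noncomputable def psiLine (n : ℤ) : C(ℝ, pathComponent (lam n)) :=
  ⟨fun t => ⟨psiFam n t, psiFam_mem n t⟩, (psiFam n).continuous.subtype_mk _⟩

lemma psiFam_add_int (n m : ℤ) (t : ℝ) : psiFam n (t + m) = psiFam n t :=
  ContinuousMap.ext fun z => show u2diag (z ^ n * Circle.exp (2 * Real.pi * (t + m))) =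
      u2diag (z ^ n * Circle.exp (2 * Real.pi * t)) by
    rw [mul_add, Circle.exp_add, Circle.exp_two_pi_mul_int, mul_one]

lemma psiLine_add_int (n m : ℤ) (t : ℝ) : psiLine n (t + m) = psiLine n t :=
  Subtype.ext (psiFam_add_int n m t)

lemma psiLine_int (n m : ℤ) : psiLine n m = lamPt n := by
  rw [← zero_add (m : ℝ), psiLine_add_int]
  exact Subtype.ext (psiFam_zero n)

lemma psiLine_zero (n : ℤ) : psiLine n 0 = lamPt n := Subtype.ext (psiFam_zero n)

/-- The loop in the path component of `lam n` obtained from a path of angles. -/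
noncomputable def psiPath (n : ℤ) {m : ℤ} (α : Path (0 : ℝ) m) : Path (lamPt n) (lamPt n) :=
  (α.map (psiLine n).continuous).cast (psiLine_zero n).symm (psiLine_int n m).symm

lemma psiPath_homotopic (n : ℤ) {m : ℤ} (α β : Path (0 : ℝ) m) :
    (psiPath n α).Homotopic (psiPath n β) :=
  ((SimplyConnectedSpace.paths_homotopic α β).map (psiLine n)).pathCast _ _

/-- The straight path from `a` to `b` in the real line. -/
noncomputable def realSegment (a b : ℝ) : Path a b where
  toFun t := a + t * (b - a)
  continuous_toFun := by fun_prop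
  source' := by simp
  target' := by simp

/-- The class of the loop winding `m` times along `psiLoop n`. -/
noncomputable def psiWind (n m : ℤ) : FundamentalGroup (pathComponent (lam n)) (lamPt n) :=
  FundamentalGroup.fromPath (Path.Homotopic.Quotient.mk (psiPath n (realSegment 0 m)))

lemma psiWind_zero (n : ℤ) : psiWind n 0 = 1 := by
  rw [FundamentalGroup.one_def, ← Path.Homotopic.Quotient.mk_refl]
  apply congrArg Path.Homotopic.Quotient.mk
  ext1
  funext t
  simp [psiPath, realSegment, psiLine_zero]

lemma psiWind_add_one (n m : ℤ) : psiWind n (m + 1) = psiWind n m * psiClass n := by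
  have h : (psiLoop n).trans (psiPath n (realSegment 0 m)) =
      psiPath n (((realSegment 0 1).trans (realSegment 1 (m + 1))).cast rfl
        (by push_cast; rfl) : Path (0 : ℝ) ((m + 1 : ℤ) : ℝ)) := by
    ext1
    funext t
    simp only [psiPath, Path.trans_apply, Path.cast_coe, Path.map_coe, Function.comp_apply]
    split_ifs with ht
    · simp [realSegment, psiLoop, psiLine]
    · simp only [realSegment, Path.coe_mk_mk]
      rw [add_comm (1 : ℝ), ← Int.cast_one, psiLine_add_int]
      simp
  rw [FundamentalGroup.mul_def]
  change Path.Homotopic.Quotient.mk _ = (Path.Homotopic.Quotient.mk (psiLoop n)).trans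
    (Path.Homotopic.Quotient.mk _)
  rw [← Path.Homotopic.Quotient.mk_trans, h, Path.Homotopic.Quotient.eq]
  exact psiPath_homotopic n _ _

lemma psiWind_eq_zpow (n m : ℤ) : psiWind n m = psiClass n ^ m := by
  induction m with
  | zero => rw [psiWind_zero, _root_.zpow_zero]
  | succ k ih => rw [psiWind_add_one, ih, _root_.zpow_add_one]
  | pred k ih =>
    have h := psiWind_add_one n (-k - 1)
    rw [sub_add_cancel, ih] at h
    rw [_root_.zpow_sub_one, h, mul_inv_cancel_right]

/-- The determinant at the base point of the circle. -/
noncomputable def detAtOne (n : ℤ) : C(pathComponent (lam n), Circle) :=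
  ⟨fun g => u2Det (g.1 1), u2Det.continuous.comp
    ((ContinuousEvalConst.continuous_eval_const 1).comp continuous_subtype_val)⟩

lemma psiWind_injective (n : ℤ) : Function.Injective (psiWind n) := by
  intro m m' h
  have h1 : (psiPath n (realSegment 0 m)).Homotopic (psiPath n (realSegment 0 m')) :=
    Path.Homotopic.Quotient.eq.1 h
  have h2 := h1.map (detAtOne n)
  let Γ (k : ℤ) : C(I, ℝ) := ⟨fun t => 2 * Real.pi * (t * k), by fun_prop⟩
  have hΓ (k : ℤ) : Circle.exp ∘ Γ k =
      ((psiPath n (realSegment 0 k)).map (detAtOne n).continuous).toContinuousMap := by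
    funext t
    change _ = u2Det (u2diag _)
    simp [u2Det_u2diag, Γ, realSegment]
  have hΓ0 (k : ℤ) : Γ k 0 = 0 := by simp [Γ]
  have h0 (k : ℤ) : ((psiPath n (realSegment 0 k)).map
      (detAtOne n).continuous).toContinuousMap 0 = Circle.exp 0 := by
    rw [← hΓ k, Function.comp_apply, hΓ0]
  have h3 := Circle.isCoveringMap_exp.liftPath_apply_one_eq_of_homotopicRel h2 0 (h0 m) (h0 m')
  rw [← (Circle.isCoveringMap_exp.eq_liftPath_iff' (h0 m)).2 ⟨hΓ m, hΓ0 m⟩,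
    ← (Circle.isCoveringMap_exp.eq_liftPath_iff' (h0 m')).2 ⟨hΓ m', hΓ0 m'⟩] at h3
  simpa [Γ, Real.pi_ne_zero] using h3

lemma exists_angle_lift (d : C(I × Circle, Circle)) (h0 : ∀ z, d (0, z) = 1)
    (h1 : ∀ z, d (1, z) = 1) :
    ∃ (θ : C(I × Circle, ℝ)) (m : ℤ), (∀ p, Circle.exp (θ p) = d p) ∧ (∀ z, θ (0, z) = 0) ∧
      ∀ z, θ (1, z) = 2 * Real.pi * m := by
  have H0 : ∀ z : Circle, d (0, z) = Circle.exp (ContinuousMap.const Circle (0 : ℝ) z) := by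
    simp [h0]
  let θ := Circle.isCoveringMap_exp.liftHomotopy d (ContinuousMap.const _ 0) H0
  have hθ : ∀ p, Circle.exp (θ p) = d p :=
    congrFun (Circle.isCoveringMap_exp.liftHomotopy_lifts d _ H0)
  obtain ⟨m, hm⟩ := Circle.exp_eq_one.1 ((hθ (1, 1)).trans (h1 1))
  have hconst : ∀ z, θ (1, z) = θ (1, 1) := fun z =>
    Circle.isCoveringMap_exp.const_of_comp (g := fun z => θ (1, z)) (by fun_prop)
      (fun a b => by simp only [hθ, h1]) z 1
  exact ⟨θ, m, hθ, Circle.isCoveringMap_exp.liftHomotopy_zero d _ H0, fun z => by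
    rw [hconst, hm]; ring⟩

/-- A homotopy of loops of maps, relative to the ends, restricts to the path component. -/
lemma path_homotopic_of_cylinder {n : ℤ} {γ δ : Path (lamPt n) (lamPt n)}
    (H : C((I × I) × Circle, Matrix.unitaryGroup (Fin 2) ℂ))
    (h0 : ∀ t z, H ((0, t), z) = (γ t).1 z) (h1 : ∀ t z, H ((1, t), z) = (δ t).1 z)
    (hs : ∀ s z, H ((s, 0), z) = lam n z) (ht : ∀ s z, H ((s, 1), z) = lam n z) :
    γ.Homotopic δ := by
  have hmem : ∀ p, H.curry p ∈ pathComponent (lam n) := fun p => by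
    let c : Path (lam n) (H.curry p) :=
      { toFun := fun r => H.curry (p.1, r * p.2)
        continuous_toFun := by fun_prop
        source' := ContinuousMap.ext fun z => by simpa using hs p.1 z
        target' := by simp }
    exact ⟨c⟩
  refine ⟨⟨⟨⟨fun p => ⟨H.curry p, hmem p⟩, H.curry.continuous.subtype_mk _⟩, fun t => ?_,
    fun t => ?_⟩, ?_⟩⟩
  · exact Subtype.ext (ContinuousMap.ext fun z => h0 t z)
  · exact Subtype.ext (ContinuousMap.ext fun z => h1 t z)
  · rintro s t (rfl | rfl)
    · refine Subtype.ext (ContinuousMap.ext fun z => ?_)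
      exact (hs s z).trans (by rw [show γ.toContinuousMap 0 = lamPt n from γ.source]; rfl)
    · refine Subtype.ext (ContinuousMap.ext fun z => ?_)
      exact (ht s z).trans (by rw [show γ.toContinuousMap 1 = lamPt n from γ.target]; rfl)

lemma psiWind_surjective (n : ℤ) : Function.Surjective (psiWind n) := by
  intro g
  obtain ⟨γ, rfl⟩ : ∃ γ : Path (lamPt n) (lamPt n), Path.Homotopic.Quotient.mk γ = g :=
    Path.Homotopic.Quotient.mk_surjective g
  let F : C(I × Circle, Matrix.unitaryGroup (Fin 2) ℂ) :=
    ContinuousMap.uncurry ⟨fun t => (γ t).1, by fun_prop⟩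
  have hF0 : ∀ z, F (0, z) = u2diag (z ^ n) := fun z =>
    congrArg (fun l => l.1 z) γ.source
  have hF1 : ∀ z, F (1, z) = u2diag (z ^ n) := fun z =>
    congrArg (fun l => l.1 z) γ.target
  obtain ⟨θ, m, hθ, hθ0, hθ1⟩ := exists_angle_lift
    ⟨fun p => u2Det (F p) * (p.2 ^ n)⁻¹, (u2Det.continuous.comp F.continuous).mul
      ((continuous_zpow n).comp continuous_snd).inv⟩
    (fun z => by simp [hF0, u2Det_u2diag]) (fun z => by simp [hF1, u2Det_u2diag])
  obtain ⟨K⟩ := homotopicRel_const_of_cylinder (by simp)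
    (u2Row.comp F) rowOne (fun z => by simp [hF0, u2Row_u2diag])
    (fun z => by simp [hF1, u2Row_u2diag])
  have hK : ∀ s t z, t = 0 ∨ t = 1 → K (s, (t, z)) = rowOne := fun s t z h => by
    rw [K.eq_snd s (show (t, z) ∈ _ from h)]
    rfl
  have hcont : Continuous fun p : (I × I) × Circle => (K (p.1.1, (p.1.2, p.2)), p.2 ^ n *
      Circle.exp (θ (p.1.2, p.2) + p.1.1 * (2 * Real.pi * (p.1.2 * m) - θ (p.1.2, p.2)))) :=
    .prodMk (by fun_prop) (((continuous_zpow n).comp continuous_snd).mul (by fun_prop))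
  refine ⟨m, (Path.Homotopic.Quotient.eq.2 (path_homotopic_of_cylinder
    (u2Mk.comp ⟨_, hcont⟩) ?_ ?_ ?_ ?_)).symm⟩
  · intro t z
    simp only [ContinuousMap.comp_apply, ContinuousMap.coe_mk]
    rw [K.apply_zero]
    simp [hθ]
    exact u2Mk_row_det (F (t, z))
  · intro t z
    simp only [ContinuousMap.comp_apply, ContinuousMap.coe_mk]
    rw [K.apply_one]
    simp [u2Mk_one]
    change _ = u2diag (z ^ n * Circle.exp (2 * Real.pi * (0 + t * (m - 0))))
    rw [zero_add, sub_zero]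
  · intro s z
    simp only [ContinuousMap.comp_apply, ContinuousMap.coe_mk]
    rw [hK _ _ _ (Or.inl rfl)]
    simp [hθ0, u2Mk_one, lam]
  · intro s z
    simp only [ContinuousMap.comp_apply, ContinuousMap.coe_mk]
    rw [hK _ _ _ (Or.inr rfl)]
    simp [hθ1, u2Mk_one, lam, Circle.exp_two_pi_mul_int]

end LoopComponent

/-- The fundamental group `π₁(L U(2)_n, λ_n)` of the path component `L U(2)_n` of
`λ_n(e^{is}) = diag(1, e^{ins})` in the free loop space `L U(2)`, based at `λ_n`, is
infinite cyclic, generated by the homotopy class of the loop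
`ψ_n(e^{it}) = (e^{is} ↦ diag(1, e^{i(ns+t)}))`: every element is a unique integer power
of the class of `ψ_n`. -/
theorem pi1_loopU2_component_infinite_cyclic (n : ℤ)
    (g : FundamentalGroup (pathComponent (lam n)) (lamPt n)) :
    ∃! m : ℤ, g = psiClass n ^ m := by
  obtain ⟨m, rfl⟩ := psiWind_surjective n g
  refine ⟨m, psiWind_eq_zpow n m, fun k hk => ?_⟩
  exact psiWind_injective n ((psiWind_eq_zpow n k).trans hk.symm)
end
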